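/- arXiv:2601.10683 — 5 statements merged into one kernel-verified Lean document; each statement's English description precedes it below -/
import Mathlib

section
/- For integers n ≥ 2 and 1 ≤ i ≤ n−1, write |γ_i^n⟩ for the vector |γ_i⟩ built with parameter n. Then the partial trace over the n-th ℂ^{d₂} tensor factor satisfies Tr_{B,n}(|γ_i^n⟩⟨γ_i^n|) = (binom(n−1,i)/binom(n,i)) · |γ_i^{n−1}⟩⟨γ_i^{n−1}| ⊗ I_{d₁} + (binom(n−1,i−1)/binom(n,i)) · |γ_{i−1}^{n−1}⟩⟨γ_{i−1}^{n−1}| ⊗ I_{d₁}, where I_{d₁} is the identity on the n-th ℂ^{d₁} tensor factor. -/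
open scoped BigOperators ComplexOrder
open Classical Matrix MeasureTheory

noncomputable section

/-- Vectorization of a `d₂ × d₁` matrix: `vec(X) ∈ ℂ^{d₂} ⊗ ℂ^{d₁}`. -/
def vecM {d₁ d₂ : ℕ} (X : Matrix (Fin d₂) (Fin d₁) ℂ) : Fin d₂ × Fin d₁ → ℂ :=
  fun p => X p.1 p.2

/-- Rank-one outer product `|v⟩⟨v|`. -/
def outer {ι : Type*} (v : ι → ℂ) : Matrix ι ι ℂ :=
  fun i j => v i * star (v j)

/-- The isometry `V₀ = ∑_{i=1}^{d₁} |i⟩⟨i|` from `ℂ^{d₁}` to `ℂ^{d₂}`. -/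
def V0mat (d₁ d₂ : ℕ) : Matrix (Fin d₂) (Fin d₁) ℂ :=
  fun a b => if (a : ℕ) = (b : ℕ) then 1 else 0

/-- The isometry `Δ = ∑_{i=1}^{d₁} |d₁+i⟩⟨i|` from `ℂ^{d₁}` to `ℂ^{d₂}`. -/
def Dmat (d₁ d₂ : ℕ) : Matrix (Fin d₂) (Fin d₁) ℂ :=
  fun a b => if (a : ℕ) = d₁ + (b : ℕ) then 1 else 0

/-- The block unitary `I_{d₁} ⊕ U` on `ℂ^{d₂}`. -/
def embedU (d₁ d₂ : ℕ) (U : Matrix (Fin (d₂ - d₁)) (Fin (d₂ - d₁)) ℂ) :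
    Matrix (Fin d₂) (Fin d₂) ℂ :=
  fun a b =>
    if ha : d₁ ≤ (a : ℕ) then
      if hb : d₁ ≤ (b : ℕ) then
        U ⟨(a : ℕ) - d₁, by have := a.isLt; omega⟩ ⟨(b : ℕ) - d₁, by have := b.isLt; omega⟩
      else 0
    else if (a : ℕ) = (b : ℕ) then 1 else 0

/-- The vector `|γ_i⟩ = binom(n,i)^{-1/2} ∑_{|S| = i} ⊗_j w_j` with `w_j = vec(Δ)` for `j ∈ S`
and `w_j = vec(V₀)` otherwise. -/
def gammaVec (d₁ d₂ n i : ℕ) : (Fin n → Fin d₂ × Fin d₁) → ℂ :=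
  fun f => ((Real.sqrt (n.choose i) : ℂ))⁻¹ *
    ∑ S ∈ Finset.powersetCard i (Finset.univ : Finset (Fin n)),
      ∏ j, (if j ∈ S then vecM (Dmat d₁ d₂) (f j) else vecM (V0mat d₁ d₂) (f j))


/-- Splitting a sum over `(i + 1)`-element subsets of `Fin (m + 1)` according to whether the
subset contains the last element. -/
lemma sum_powersetCard_prod_ite_castSucc (m i : ℕ) (u v : Fin (m + 1) → ℂ) :
    ∑ S ∈ Finset.powersetCard (i + 1) (Finset.univ : Finset (Fin (m + 1))),
        ∏ j, (if j ∈ S then u j else v j) =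
      v (Fin.last m) * ∑ S ∈ Finset.powersetCard (i + 1) (Finset.univ : Finset (Fin m)),
          ∏ j, (if j ∈ S then u j.castSucc else v j.castSucc) +
        u (Fin.last m) * ∑ S ∈ Finset.powersetCard i (Finset.univ : Finset (Fin m)),
          ∏ j, (if j ∈ S then u j.castSucc else v j.castSucc) := by
  have hlast (S : Finset (Fin m)) : Fin.last m ∉ S.map Fin.castSuccEmb := by
    simp [Fin.castSucc_ne_last]
  have hne (j : Fin m) : j.castSucc ≠ Fin.last m := Fin.castSucc_ne_last j
  rw [Fin.univ_castSuccEmb, Finset.cons_eq_insert,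
    Finset.powersetCard_succ_insert (hlast _), Finset.sum_union, Finset.sum_image,
    Finset.powersetCard_map, Finset.powersetCard_map, Finset.sum_map, Finset.sum_map,
    Finset.mul_sum, Finset.mul_sum]
  · congr 1 <;> refine Finset.sum_congr rfl fun S _ => ?_
    · rw [← Finset.cons_eq_insert _ _ (hlast _), ← Fin.univ_castSuccEmb,
        Fin.prod_univ_castSucc, mul_comm]
      simp [Finset.mapEmbedding_apply, hne]
    · rw [← Finset.cons_eq_insert _ _ (hlast _), ← Fin.univ_castSuccEmb,
        Fin.prod_univ_castSucc, mul_comm]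
      simp [Finset.mapEmbedding_apply, hne]
  · intro S hS T hT h
    have hmem {S : Finset (Fin (m + 1))}
        (hS : S ∈ Finset.powersetCard i (Finset.univ.map Fin.castSuccEmb)) :
        Fin.last m ∉ S := fun hl => hlast _ ((Finset.mem_powersetCard.1 hS).1 hl)
    rw [← Finset.erase_insert (hmem hS), ← Finset.erase_insert (hmem hT)]
    exact congrArg (fun X => X.erase (Fin.last m)) h
  · rw [Finset.disjoint_left]
    intro S hS hT
    obtain ⟨T, _, rfl⟩ := Finset.mem_image.1 hT
    exact hlast _ ((Finset.mem_powersetCard.1 hS).1 (Finset.mem_insert_self _ _))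

/-- The recursion for `γ_{i+1}` in the number of tensor factors, with normalizations cleared. -/
lemma gammaVec_snoc (d₁ d₂ m i : ℕ) (hi : i + 1 ≤ m) (f : Fin m → Fin d₂ × Fin d₁)
    (x : Fin d₂ × Fin d₁) :
    gammaVec d₁ d₂ (m + 1) (i + 1) (Fin.snoc f x) =
      ((Real.sqrt ((m + 1).choose (i + 1)) : ℂ))⁻¹ *
        (vecM (V0mat d₁ d₂) x *
            ((Real.sqrt (m.choose (i + 1)) : ℂ) * gammaVec d₁ d₂ m (i + 1) f) +
          vecM (Dmat d₁ d₂) x * ((Real.sqrt (m.choose i) : ℂ) * gammaVec d₁ d₂ m i f)) := by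
  have hsqrt {k : ℕ} (hk : k ≤ m) : (Real.sqrt (m.choose k) : ℂ) ≠ 0 := by
    have := Nat.choose_pos hk
    exact Complex.ofReal_ne_zero.2 (Real.sqrt_pos.2 (by exact_mod_cast this)).ne'
  unfold gammaVec
  rw [sum_powersetCard_prod_ite_castSucc, mul_inv_cancel_left₀ (hsqrt hi),
    mul_inv_cancel_left₀ (hsqrt (by omega))]
  simp only [Fin.snoc_last, Fin.snoc_castSucc]

lemma sum_V0mat_mul_V0mat {d₁ d₂ : ℕ} (h : d₁ ≤ d₂) (a a' : Fin d₁) :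
    ∑ b, V0mat d₁ d₂ b a * V0mat d₁ d₂ b a' = if a = a' then 1 else 0 := by
  rw [Finset.sum_eq_single (⟨a, by omega⟩ : Fin d₂)]
  · simp [V0mat, Fin.ext_iff]
  · intro b _ hb
    have : (b : ℕ) ≠ a := fun h => hb (Fin.ext h)
    simp [V0mat, this]
  · simp

lemma sum_Dmat_mul_Dmat {d₁ d₂ : ℕ} (h : 2 * d₁ ≤ d₂) (a a' : Fin d₁) :
    ∑ b, Dmat d₁ d₂ b a * Dmat d₁ d₂ b a' = if a = a' then 1 else 0 := by
  rw [Finset.sum_eq_single (⟨d₁ + a, by omega⟩ : Fin d₂)]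
  · simp [Dmat, Fin.ext_iff]
  · intro b _ hb
    have : (b : ℕ) ≠ d₁ + a := fun h => hb (Fin.ext h)
    simp [Dmat, this]
  · simp

lemma V0mat_mul_Dmat {d₁ d₂ : ℕ} (b : Fin d₂) (a a' : Fin d₁) :
    V0mat d₁ d₂ b a * Dmat d₁ d₂ b a' = 0 := by
  have : ¬ ((b : ℕ) = a ∧ (b : ℕ) = d₁ + a') := by omega
  simp only [V0mat, Dmat]
  split_ifs <;> simp_all

lemma star_V0mat {d₁ d₂ : ℕ} (b : Fin d₂) (a : Fin d₁) :
    star (V0mat d₁ d₂ b a) = V0mat d₁ d₂ b a := by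
  simp only [V0mat]
  split_ifs <;> simp

lemma star_Dmat {d₁ d₂ : ℕ} (b : Fin d₂) (a : Fin d₁) :
    star (Dmat d₁ d₂ b a) = Dmat d₁ d₂ b a := by
  simp only [Dmat]
  split_ifs <;> simp

lemma ofReal_sqrt_natCast_mul_self (k : ℕ) :
    (Real.sqrt k : ℂ) * (Real.sqrt k : ℂ) = k := by
  rw [← Complex.ofReal_mul, Real.mul_self_sqrt (Nat.cast_nonneg k), Complex.ofReal_natCast]

/-- the partial trace over the last `ℂ^{d₂}` factor of `|γ_i^{n}⟩⟨γ_i^{n}|`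
(for `n = m+1 ≥ 2` and `1 ≤ i ≤ n-1 = m`), written entrywise:
`Tr_{B,n}(|γ_i^n⟩⟨γ_i^n|) = (binom(n-1,i)/binom(n,i))·|γ_i^{n-1}⟩⟨γ_i^{n-1}|⊗I_{d₁}
  + (binom(n-1,i-1)/binom(n,i))·|γ_{i-1}^{n-1}⟩⟨γ_{i-1}^{n-1}|⊗I_{d₁}`. -/
theorem gamma_partial_trace_last (d₁ d₂ : ℕ) (hd₁ : 0 < d₁) (hd : 2 * d₁ ≤ d₂)
    (m i : ℕ) (hm : 1 ≤ m) (hi1 : 1 ≤ i) (hi2 : i ≤ m) :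
    ∀ (f g : Fin m → Fin d₂ × Fin d₁) (a a' : Fin d₁),
      (∑ b : Fin d₂,
          gammaVec d₁ d₂ (m + 1) i (Fin.snoc f (b, a)) *
            star (gammaVec d₁ d₂ (m + 1) i (Fin.snoc g (b, a')))) =
        (if a = a' then (1 : ℂ) else 0) *
          (((m.choose i : ℂ) / ((m + 1).choose i : ℂ)) *
              (gammaVec d₁ d₂ m i f * star (gammaVec d₁ d₂ m i g)) +
            ((m.choose (i - 1) : ℂ) / ((m + 1).choose i : ℂ)) *
              (gammaVec d₁ d₂ m (i - 1) f * star (gammaVec d₁ d₂ m (i - 1) g))) := by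
  intro f g a a'
  obtain ⟨i, rfl⟩ : ∃ k, i = k + 1 := ⟨i - 1, by omega⟩
  simp only [Nat.add_sub_cancel]
  have hstar (r : ℝ) : star (r : ℂ) = r := Complex.conj_ofReal r
  have hterm (b : Fin d₂) :
      gammaVec d₁ d₂ (m + 1) (i + 1) (Fin.snoc f (b, a)) *
          star (gammaVec d₁ d₂ (m + 1) (i + 1) (Fin.snoc g (b, a'))) =
        V0mat d₁ d₂ b a * V0mat d₁ d₂ b a' *
            (((m.choose (i + 1) : ℂ) / ((m + 1).choose (i + 1) : ℂ)) *
              (gammaVec d₁ d₂ m (i + 1) f * star (gammaVec d₁ d₂ m (i + 1) g))) +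
          Dmat d₁ d₂ b a * Dmat d₁ d₂ b a' *
            (((m.choose i : ℂ) / ((m + 1).choose (i + 1) : ℂ)) *
              (gammaVec d₁ d₂ m i f * star (gammaVec d₁ d₂ m i g))) := by
    rw [gammaVec_snoc _ _ _ _ hi2, gammaVec_snoc _ _ _ _ hi2]
    simp only [vecM, star_mul', star_add, star_inv₀, hstar, star_V0mat, star_Dmat, div_eq_mul_inv,
      ← ofReal_sqrt_natCast_mul_self (m.choose _),
      ← ofReal_sqrt_natCast_mul_self ((m + 1).choose _), mul_inv]
    have h₁ := V0mat_mul_Dmat b a a'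
    have h₂ := V0mat_mul_Dmat b a' a
    generalize V0mat d₁ d₂ b a = p at *
    generalize V0mat d₁ d₂ b a' = p' at *
    generalize Dmat d₁ d₂ b a = q at *
    generalize Dmat d₁ d₂ b a' = q' at *
    generalize ((Real.sqrt ((m + 1).choose (i + 1)) : ℂ))⁻¹ = c
    generalize (Real.sqrt (m.choose (i + 1)) : ℂ) = s
    generalize (Real.sqrt (m.choose i) : ℂ) = t
    generalize gammaVec d₁ d₂ m (i + 1) f = F
    generalize gammaVec d₁ d₂ m i f = F'
    generalize star (gammaVec d₁ d₂ m (i + 1) g) = G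
    generalize star (gammaVec d₁ d₂ m i g) = G'
    linear_combination c * c * s * t * F * G' * h₁ + c * c * s * t * F' * G * h₂
  simp only [hterm, Finset.sum_add_distrib, ← Finset.sum_mul]
  rw [sum_V0mat_mul_V0mat (by omega), sum_Dmat_mul_Dmat hd, mul_add]

end
end

section
/- For every integer n ≥ 1 and every unitary U ∈ U(d₂−d₁), the n-fold tensor power of the vectorized isometry decomposes as vec(V_{ε,U})^{⊗n} = Σ_{i=0}^{n} (√(1−ε²))^{n−i} · ε^i · √binom(n,i) · (I_{d₁}⊕U)^{⊗n}_B |γ_i⟩. -/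
open scoped BigOperators ComplexOrder
open Classical Matrix MeasureTheory

noncomputable section

/-- The action of `((I_{d₁} ⊕ U)^{⊗n})_B` (acting as `I_{d₁} ⊕ U` on each `ℂ^{d₂}` factor and
trivially on each `ℂ^{d₁}` factor) on a vector of `(ℂ^{d₂} ⊗ ℂ^{d₁})^{⊗n}`. -/
def rotB (d₁ d₂ n : ℕ) (U : Matrix (Fin (d₂ - d₁)) (Fin (d₂ - d₁)) ℂ)
    (v : (Fin n → Fin d₂ × Fin d₁) → ℂ) : (Fin n → Fin d₂ × Fin d₁) → ℂ :=
  fun f => ∑ g : Fin n → Fin d₂ × Fin d₁,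
    (∏ j, (embedU d₁ d₂ U (f j).1 (g j).1 * (if (f j).2 = (g j).2 then (1 : ℂ) else 0))) * v g


/-- The "hard" isometry `V_{ε,U} = √(1-ε²)·V₀ + ε·(I_{d₁} ⊕ U)·Δ`. -/
def Vmat (d₁ d₂ : ℕ) (ε : ℝ) (U : Matrix (Fin (d₂ - d₁)) (Fin (d₂ - d₁)) ℂ) :
    Matrix (Fin d₂) (Fin d₁) ℂ :=
  (Real.sqrt (1 - ε ^ 2) : ℂ) • V0mat d₁ d₂ + (ε : ℂ) • (embedU d₁ d₂ U * Dmat d₁ d₂)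

/-- `n`-fold tensor power of a vector. -/
def tpow {ι : Type*} (v : ι → ℂ) (n : ℕ) : (Fin n → ι) → ℂ :=
  fun f => ∏ j, v (f j)

/-- The block unitary fixes the range of `V₀`. -/
theorem embedU_mul_V0mat (d₁ d₂ : ℕ) (hd : d₁ ≤ d₂)
    (U : Matrix (Fin (d₂ - d₁)) (Fin (d₂ - d₁)) ℂ) :
    embedU d₁ d₂ U * V0mat d₁ d₂ = V0mat d₁ d₂ := by
  ext a b
  rw [Matrix.mul_apply, Finset.sum_eq_single (⟨b, b.isLt.trans_le hd⟩ : Fin d₂)]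
  · have hb : ¬ d₁ ≤ (b : ℕ) := not_le.mpr b.isLt
    by_cases ha : d₁ ≤ (a : ℕ)
    · have hab : (a : ℕ) ≠ b := by omega
      simp [embedU, V0mat, ha, hab]
    · simp [embedU, V0mat, ha]
  · intro c _ hc
    have hcb : (c : ℕ) ≠ b := fun h => hc (Fin.ext h)
    simp [V0mat, hcb]
  · simp

/-- Acting by `M ⊗ I` on `vec(X)` is the vectorization of `M * X`. -/
theorem sum_mul_vecM {d₁ d₂ : ℕ} (M : Matrix (Fin d₂) (Fin d₂) ℂ)
    (X : Matrix (Fin d₂) (Fin d₁) ℂ) (p : Fin d₂ × Fin d₁) :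
    ∑ q : Fin d₂ × Fin d₁, M p.1 q.1 * (if p.2 = q.2 then (1 : ℂ) else 0) * vecM X q =
      vecM (M * X) p := by
  simp [Fintype.sum_prod_type, vecM, Matrix.mul_apply]

/-- The block unitary acts factorwise on each term of `|γ_i⟩`. -/
theorem rotB_gammaVec (d₁ d₂ n i : ℕ) (U : Matrix (Fin (d₂ - d₁)) (Fin (d₂ - d₁)) ℂ)
    (f : Fin n → Fin d₂ × Fin d₁) :
    rotB d₁ d₂ n U (gammaVec d₁ d₂ n i) f = ((Real.sqrt (n.choose i) : ℂ))⁻¹ *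
      ∑ S ∈ Finset.powersetCard i (Finset.univ : Finset (Fin n)),
        ∏ j, (if j ∈ S then vecM (embedU d₁ d₂ U * Dmat d₁ d₂) (f j)
          else vecM (embedU d₁ d₂ U * V0mat d₁ d₂) (f j)) := by
  simp only [rotB, gammaVec, Finset.mul_sum]
  rw [Finset.sum_comm]
  refine Finset.sum_congr rfl fun S _ => ?_
  have hfactor : ∀ j, (if j ∈ S then vecM (embedU d₁ d₂ U * Dmat d₁ d₂) (f j)
      else vecM (embedU d₁ d₂ U * V0mat d₁ d₂) (f j)) =
      ∑ q : Fin d₂ × Fin d₁, embedU d₁ d₂ U (f j).1 q.1 *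
        (if (f j).2 = q.2 then (1 : ℂ) else 0) *
        (if j ∈ S then vecM (Dmat d₁ d₂) q else vecM (V0mat d₁ d₂) q) := by
    intro j
    split_ifs <;> rw [sum_mul_vecM]
  simp_rw [hfactor]
  rw [Finset.prod_univ_sum, Fintype.piFinset_univ, Finset.mul_sum]
  refine Finset.sum_congr rfl fun g _ => ?_
  simp only [Finset.prod_mul_distrib]
  ring

/-- Binomial expansion of a product of two-term sums, grouped by subset size. -/
theorem prod_mul_add_mul_eq_sum_powersetCard {R : Type*} [CommSemiring R] (n : ℕ) (a b : R)
    (x y : Fin n → R) :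
    ∏ j, (a * x j + b * y j) = ∑ i ∈ Finset.range (n + 1), a ^ (n - i) * b ^ i *
      ∑ S ∈ Finset.powersetCard i (Finset.univ : Finset (Fin n)),
        ∏ j, (if j ∈ S then y j else x j) := by
  simp_rw [add_comm (a * _)]
  rw [Finset.prod_add, Finset.sum_powerset, Finset.card_univ, Fintype.card_fin]
  refine Finset.sum_congr rfl fun i _ => ?_
  rw [Finset.mul_sum]
  refine Finset.sum_congr rfl fun S hS => ?_
  have hcard : S.card = i := (Finset.mem_powersetCard.mp hS).2
  have hcompl : (Finset.univ \ S).card = n - i := by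
    rw [Finset.card_univ_sdiff, Fintype.card_fin, hcard]
  rw [Finset.prod_mul_distrib, Finset.prod_mul_distrib, Finset.prod_const, Finset.prod_const,
    hcard, hcompl, Finset.prod_ite]
  simp only [Finset.filter_mem_eq_inter, Finset.univ_inter, Finset.filter_notMem_eq_sdiff]
  ring

/-- the decomposition
`vec(V_{ε,U})^{⊗n} = ∑_{i=0}^n (√(1-ε²))^{n-i} ε^i √binom(n,i) (I_{d₁}⊕U)_B^{⊗n} |γ_i⟩`. -/
theorem vec_tensor_power_decomposition (d₁ d₂ : ℕ) (hd₁ : 0 < d₁) (hd : 2 * d₁ ≤ d₂)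
    (ε : ℝ) (hε0 : 0 < ε) (hε1 : ε < 1) (n : ℕ) (hn : 1 ≤ n)
    (U : Matrix.unitaryGroup (Fin (d₂ - d₁)) ℂ) :
    ∀ f : Fin n → Fin d₂ × Fin d₁,
      tpow (vecM (Vmat d₁ d₂ ε ↑U)) n f =
        ∑ i ∈ Finset.range (n + 1),
          ((Real.sqrt (1 - ε ^ 2) : ℂ)) ^ (n - i) * (ε : ℂ) ^ i *
            (Real.sqrt (n.choose i) : ℂ) * rotB d₁ d₂ n (↑U) (gammaVec d₁ d₂ n i) f := by
  intro f
  have hfactor : ∀ j, vecM (Vmat d₁ d₂ ε ↑U) (f j) =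
      (Real.sqrt (1 - ε ^ 2) : ℂ) * vecM (V0mat d₁ d₂) (f j) +
        (ε : ℂ) * vecM (embedU d₁ d₂ ↑U * Dmat d₁ d₂) (f j) := fun j => by
    simp [vecM, Vmat]
  simp only [tpow, hfactor]
  rw [prod_mul_add_mul_eq_sum_powersetCard]
  refine Finset.sum_congr rfl fun i hi => ?_
  have hchoose : (Real.sqrt (n.choose i) : ℂ) ≠ 0 := by
    have hpos : 0 < n.choose i := Nat.choose_pos (Nat.lt_succ_iff.mp (Finset.mem_range.mp hi))
    exact_mod_cast (Real.sqrt_pos.mpr (Nat.cast_pos.mpr hpos)).ne'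
  rw [rotB_gammaVec, embedU_mul_V0mat d₁ d₂ (by omega), mul_assoc (_ * _),
    mul_inv_cancel_left₀ hchoose]

end
end

section
/- For every integer n ≥ 1: (i) the vectors γ_0, …, γ_n satisfy ⟨γ_i, γ_j⟩ = 𝟙_{i=j} · d₁^n, so in particular they are pairwise orthogonal; and (ii) for all i ≠ j the operators Γ_i and Γ_j have orthogonal supports, i.e. Γ_i Γ_j = 0. -/
open scoped BigOperators ComplexOrder
open Classical Matrix MeasureTheory

noncomputable section

instance matrixMeasurableSpace (ι κ : Type*) : MeasurableSpace (Matrix ι κ ℂ) :=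
  MeasurableSpace.pi

/-- The Haar average `Γ_i = ∫ (I⊕U)_B^{⊗n} |γ_i⟩⟨γ_i| ((I⊕U)_B^{⊗n})^* dμ(U)`,
defined entrywise. -/
def GammaMat (d₁ d₂ n i : ℕ)
    (μ : Measure (Matrix.unitaryGroup (Fin (d₂ - d₁)) ℂ)) :
    Matrix (Fin n → Fin d₂ × Fin d₁) (Fin n → Fin d₂ × Fin d₁) ℂ :=
  fun f g => ∫ U, rotB d₁ d₂ n (↑U) (gammaVec d₁ d₂ n i) f *
      star (rotB d₁ d₂ n (↑U) (gammaVec d₁ d₂ n i) g) ∂μ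


/-- The tensor product over `j` of the vectors `vec(Δ)` for `j ∈ S` and `vec(V₀)` for `j ∉ S`. -/
def tensorVec (d₁ d₂ n : ℕ) (S : Finset (Fin n)) (f : Fin n → Fin d₂ × Fin d₁) : ℂ :=
  ∏ j, (if j ∈ S then vecM (Dmat d₁ d₂) (f j) else vecM (V0mat d₁ d₂) (f j))

/-- The tensor factors of a basis index whose `ℂ^{d₂}` component lies in the block on which the
unitary acts. -/
def upperSet {d₁ d₂ n : ℕ} (f : Fin n → Fin d₂ × Fin d₁) : Finset (Fin n) :=
  Finset.univ.filter fun j => d₁ ≤ ((f j).1 : ℕ)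

lemma star_tensorVec (d₁ d₂ n : ℕ) (S : Finset (Fin n)) (f : Fin n → Fin d₂ × Fin d₁) :
    star (tensorVec d₁ d₂ n S f) = tensorVec d₁ d₂ n S f := by
  unfold tensorVec
  rw [← starRingEnd_apply, map_prod]
  refine Finset.prod_congr rfl fun j _ => ?_
  split_ifs <;> simp only [vecM, Dmat, V0mat] <;> split_ifs <;> simp

lemma gammaVec_eq (d₁ d₂ n i : ℕ) (f : Fin n → Fin d₂ × Fin d₁) :
    gammaVec d₁ d₂ n i f = ((Real.sqrt (n.choose i) : ℂ))⁻¹ *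
      ∑ S ∈ Finset.powersetCard i (Finset.univ : Finset (Fin n)), tensorVec d₁ d₂ n S f :=
  rfl

lemma star_gammaVec (d₁ d₂ n i : ℕ) (f : Fin n → Fin d₂ × Fin d₁) :
    star (gammaVec d₁ d₂ n i f) = gammaVec d₁ d₂ n i f := by
  rw [gammaVec_eq, star_mul', star_sum]
  simp only [star_tensorVec]
  congr 1
  rw [← starRingEnd_apply, map_inv₀, Complex.conj_ofReal]

/-- The graph of a map out of `Fin d₁` has `d₁` elements. -/
lemma sum_indicator_graph {d₁ d₂ : ℕ} (e : Fin d₁ → Fin d₂) :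
    ∑ p : Fin d₂ × Fin d₁, (if (p.1 : ℕ) = (e p.2 : ℕ) then (1 : ℂ) else 0) = d₁ := by
  rw [Fintype.sum_prod_type_right]
  simp [← Fin.ext_iff]

lemma sum_vecM_mul_vecM {d₁ d₂ : ℕ} (hd : 2 * d₁ ≤ d₂) (P Q : Prop) [Decidable P]
    [Decidable Q] :
    ∑ p : Fin d₂ × Fin d₁, (if P then vecM (Dmat d₁ d₂) p else vecM (V0mat d₁ d₂) p) *
      (if Q then vecM (Dmat d₁ d₂) p else vecM (V0mat d₁ d₂) p) =
      if P ↔ Q then (d₁ : ℂ) else 0 := by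
  have hD := sum_indicator_graph (d₁ := d₁) (d₂ := d₂) fun b => ⟨d₁ + b, by omega⟩
  have hV := sum_indicator_graph (d₁ := d₁) (d₂ := d₂) fun b => ⟨b, by omega⟩
  by_cases hP : P <;> by_cases hQ : Q <;>
    simp only [hP, hQ, if_true, if_false, iff_true, iff_false, not_true, vecM, Dmat, V0mat]
  · rw [← hD]
    exact Finset.sum_congr rfl fun p _ => by split_ifs <;> simp
  · refine Finset.sum_eq_zero fun p _ => ?_
    have := p.2.isLt
    split_ifs <;> first | omega | simp
  · refine Finset.sum_eq_zero fun p _ => ?_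
    have := p.2.isLt
    split_ifs <;> first | omega | simp
  · rw [← hV]
    exact Finset.sum_congr rfl fun p _ => by split_ifs <;> simp

lemma sum_tensorVec_mul_tensorVec {d₁ d₂ : ℕ} (hd : 2 * d₁ ≤ d₂) (n : ℕ)
    (S T : Finset (Fin n)) :
    ∑ f, tensorVec d₁ d₂ n S f * tensorVec d₁ d₂ n T f =
      if S = T then (d₁ : ℂ) ^ n else 0 := by
  simp only [tensorVec, ← Finset.prod_mul_distrib]
  rw [← Fintype.prod_sum fun (j : Fin n) (p : Fin d₂ × Fin d₁) =>
    (if j ∈ S then vecM (Dmat d₁ d₂) p else vecM (V0mat d₁ d₂) p) *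
      (if j ∈ T then vecM (Dmat d₁ d₂) p else vecM (V0mat d₁ d₂) p)]
  simp only [sum_vecM_mul_vecM hd]
  split_ifs with h
  · simp [h]
  · obtain ⟨j, hj⟩ : ∃ j, ¬(j ∈ S ↔ j ∈ T) := by
      by_contra! h'
      exact h (Finset.ext h')
    exact Finset.prod_eq_zero (Finset.mem_univ j) (if_neg hj)

lemma sum_star_gammaVec_mul_gammaVec {d₁ d₂ : ℕ} (hd : 2 * d₁ ≤ d₂) {n i : ℕ} (hi : i ≤ n)
    (j : ℕ) :
    ∑ f, star (gammaVec d₁ d₂ n i f) * gammaVec d₁ d₂ n j f =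
      if i = j then (d₁ : ℂ) ^ n else 0 := by
  have key : ∑ f, (∑ S ∈ Finset.powersetCard i (Finset.univ : Finset (Fin n)),
        tensorVec d₁ d₂ n S f) *
      (∑ T ∈ Finset.powersetCard j (Finset.univ : Finset (Fin n)), tensorVec d₁ d₂ n T f) =
      if i = j then (n.choose i : ℂ) * (d₁ : ℂ) ^ n else 0 := by
    simp only [Finset.sum_mul_sum]
    rw [Finset.sum_comm]
    have inner (S : Finset (Fin n)) :
        ∑ f, ∑ T ∈ Finset.powersetCard j (Finset.univ : Finset (Fin n)),
          tensorVec d₁ d₂ n S f * tensorVec d₁ d₂ n T f =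
          if S.card = j then (d₁ : ℂ) ^ n else 0 := by
      rw [Finset.sum_comm]
      simp [sum_tensorVec_mul_tensorVec hd, Finset.mem_powersetCard]
    rw [Finset.sum_congr rfl fun S hS => by
      rw [inner S, (Finset.mem_powersetCard.mp hS).2]]
    simp
  have hc : ((Real.sqrt (n.choose i) : ℂ)) * (Real.sqrt (n.choose i) : ℂ) = n.choose i := by
    rw [← Complex.ofReal_mul, Real.mul_self_sqrt (Nat.cast_nonneg _), Complex.ofReal_natCast]
  have hc₀ : (n.choose i : ℂ) ≠ 0 := Nat.cast_ne_zero.mpr (Nat.choose_pos hi).ne'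
  simp only [star_gammaVec]
  simp only [gammaVec_eq, mul_mul_mul_comm]
  rw [← Finset.mul_sum, key]
  split_ifs with h
  · subst h
    rw [← mul_inv, hc, inv_mul_cancel_left₀ hc₀]
  · simp

lemma upperSet_eq_of_tensorVec_ne_zero {d₁ d₂ n : ℕ} {S : Finset (Fin n)}
    {f : Fin n → Fin d₂ × Fin d₁} (h : tensorVec d₁ d₂ n S f ≠ 0) : upperSet f = S := by
  ext j
  have hj := Finset.prod_ne_zero_iff.mp h j (Finset.mem_univ j)
  have := (f j).2.isLt
  simp only [upperSet, Finset.mem_filter, Finset.mem_univ, true_and]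
  by_cases hS : j ∈ S <;> simp only [hS, if_true, if_false, vecM, Dmat, V0mat, ne_eq,
    ite_eq_right_iff, one_ne_zero, imp_false, not_not] at hj <;> simp only [hS] <;>
    simp only [iff_true, iff_false] <;> omega

lemma card_upperSet_of_gammaVec_ne_zero {d₁ d₂ n i : ℕ} {f : Fin n → Fin d₂ × Fin d₁}
    (h : gammaVec d₁ d₂ n i f ≠ 0) : (upperSet f).card = i := by
  rw [gammaVec_eq] at h
  obtain ⟨S, hS, hSf⟩ := Finset.exists_ne_zero_of_sum_ne_zero (right_ne_zero_of_mul h)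
  rw [upperSet_eq_of_tensorVec_ne_zero hSf, (Finset.mem_powersetCard.mp hS).2]

lemma le_iff_le_of_embedU_ne_zero {d₁ d₂ : ℕ}
    {U : Matrix (Fin (d₂ - d₁)) (Fin (d₂ - d₁)) ℂ} {a b : Fin d₂}
    (h : embedU d₁ d₂ U a b ≠ 0) : d₁ ≤ (a : ℕ) ↔ d₁ ≤ (b : ℕ) := by
  unfold embedU at h
  split_ifs at h with ha hb hab
  · exact iff_of_true ha hb
  · exact absurd rfl h
  · rw [hab]
  · exact absurd rfl h

/-- The action of `I ⊕ U` preserves the number of tensor factors in the upper block. -/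
lemma card_upperSet_of_rotB_gammaVec_ne_zero {d₁ d₂ n i : ℕ}
    {U : Matrix (Fin (d₂ - d₁)) (Fin (d₂ - d₁)) ℂ} {f : Fin n → Fin d₂ × Fin d₁}
    (h : rotB d₁ d₂ n U (gammaVec d₁ d₂ n i) f ≠ 0) : (upperSet f).card = i := by
  obtain ⟨g, -, hg⟩ := Finset.exists_ne_zero_of_sum_ne_zero h
  rw [← card_upperSet_of_gammaVec_ne_zero (right_ne_zero_of_mul hg)]
  congr 1
  refine Finset.filter_congr fun j _ => le_iff_le_of_embedU_ne_zero (U := U) ?_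
  exact left_ne_zero_of_mul
    (Finset.prod_ne_zero_iff.mp (left_ne_zero_of_mul hg) j (Finset.mem_univ j))

lemma card_upperSet_of_GammaMat_ne_zero {d₁ d₂ n i : ℕ}
    {μ : Measure (Matrix.unitaryGroup (Fin (d₂ - d₁)) ℂ)} {f g : Fin n → Fin d₂ × Fin d₁}
    (h : GammaMat d₁ d₂ n i μ f g ≠ 0) : (upperSet f).card = i ∧ (upperSet g).card = i := by
  have : ∃ U : Matrix.unitaryGroup (Fin (d₂ - d₁)) ℂ,
      rotB d₁ d₂ n U (gammaVec d₁ d₂ n i) f *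
        star (rotB d₁ d₂ n U (gammaVec d₁ d₂ n i) g) ≠ 0 := by
    by_contra! h'
    exact h (by simp only [GammaMat, h', integral_zero])
  obtain ⟨U, hU⟩ := this
  exact ⟨card_upperSet_of_rotB_gammaVec_ne_zero (left_ne_zero_of_mul hU),
    card_upperSet_of_rotB_gammaVec_ne_zero (star_ne_zero.mp (right_ne_zero_of_mul hU))⟩

/-- (i) `⟨γ_i, γ_j⟩ = 𝟙_{i=j}·d₁^n`, so the `γ_i` are pairwise orthogonal;
(ii) for `i ≠ j` the Haar averages `Γ_i, Γ_j` have orthogonal supports: `Γ_i Γ_j = 0`. -/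
theorem gamma_orthogonality_and_Gamma_orthogonality (d₁ d₂ : ℕ) (hd₁ : 0 < d₁)
    (hd : 2 * d₁ ≤ d₂) (n : ℕ) (hn : 1 ≤ n)
    (μ : Measure (Matrix.unitaryGroup (Fin (d₂ - d₁)) ℂ)) [IsProbabilityMeasure μ]
    [μ.IsMulLeftInvariant] [μ.IsMulRightInvariant] :
    (∀ i ≤ n, ∀ j ≤ n,
      (∑ f : Fin n → Fin d₂ × Fin d₁, star (gammaVec d₁ d₂ n i f) * gammaVec d₁ d₂ n j f) =
        if i = j then (d₁ : ℂ) ^ n else 0) ∧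
    (∀ i ≤ n, ∀ j ≤ n, i ≠ j → GammaMat d₁ d₂ n i μ * GammaMat d₁ d₂ n j μ = 0) := by
  refine ⟨fun i hi j _ => sum_star_gammaVec_mul_gammaVec hd hi j, fun i _ j _ hij => ?_⟩
  ext f g
  rw [Matrix.mul_apply, Matrix.zero_apply]
  refine Finset.sum_eq_zero fun x _ => ?_
  by_contra hx
  exact hij ((card_upperSet_of_GammaMat_ne_zero (left_ne_zero_of_mul hx)).2.symm.trans
    (card_upperSet_of_GammaMat_ne_zero (right_ne_zero_of_mul hx)).1)

end
end

section
/- Let d, n, m be positive integers with n ≥ m. Equip ℂ^{d+1} with the standard orthonormal basis |0⟩, |1⟩, …, |d⟩, and consider the subspace A of (ℂ^{d+1})^{⊗n} defined as A = span{ Σ_{S⊆{1,…,n}, |S|=m} w_1⊗…⊗w_n : ψ ∈ ℂ^{d+1} with ⟨0|ψ⟩ = 0, where w_j = |ψ⟩ for j ∈ S and w_j = |0⟩ for j ∉ S }. Then dim(A) = binom(d+m−1, m). -/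
open scoped BigOperators

noncomputable section

/-- For each `i`, the number of positions at which `f` takes the nonzero value `i + 1`. -/
def occupation {d n : ℕ} (f : Fin n → Fin (d + 1)) : Fin d →₀ ℕ :=
  Finsupp.equivFunOnFinite.symm fun i => (Finset.univ.filter fun j => f j = i.succ).card

theorem occupation_apply {d n : ℕ} (f : Fin n → Fin (d + 1)) (i : Fin d) :
    occupation f i = (Finset.univ.filter fun j => f j = i.succ).card := rfl

theorem sum_occupation {d n : ℕ} (f : Fin n → Fin (d + 1)) :
    ∑ i, occupation f i = (Finset.univ.filter fun j => f j ≠ 0).card := by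
  rw [Finset.card_filter, ← Finset.sum_fiberwise' Finset.univ f fun i => if i ≠ 0 then 1 else 0,
    Fin.sum_univ_succ]
  simp [occupation_apply]

theorem prod_pow_occupation {R : Type*} [CommMonoid R] {d n : ℕ} (f : Fin n → Fin (d + 1))
    (ψ : Fin (d + 1) → R) :
    ∏ i : Fin d, ψ i.succ ^ occupation f i = ∏ j, if f j ≠ 0 then ψ (f j) else 1 := by
  rw [← Finset.prod_fiberwise' Finset.univ f fun i => if i ≠ 0 then ψ i else 1,
    Fin.prod_univ_succ]
  simp [occupation_apply]

theorem exists_occupation_eq {d n : ℕ} (t : Fin d →₀ ℕ) (ht : ∑ i, t i ≤ n) :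
    ∃ f : Fin n → Fin (d + 1), occupation f = t := by
  classical
  obtain ⟨l, hl⟩ : ∃ l : List (Fin (d + 1)), (l : Multiset (Fin (d + 1))) =
      t.toMultiset.map Fin.succ + Multiset.replicate (n - ∑ i, t i) 0 := Quot.exists_rep _
  have hlen : l.length = n := by
    rw [← Multiset.coe_card, hl, Multiset.card_add, Multiset.card_map, Multiset.card_replicate,
      Finsupp.card_toMultiset, Finsupp.sum_fintype _ _ fun _ => rfl]
    simp only [id]
    omega
  subst hlen
  refine ⟨l.get, Finsupp.ext fun i => ?_⟩
  have h : (Finset.univ.val.map l.get).count i.succ = t i := by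
    rw [Fin.univ_val_map, List.ofFn_get, hl, Multiset.count_add,
      Multiset.count_map_eq_count' _ _ (Fin.succ_injective d), Finsupp.count_toMultiset,
      Multiset.count_replicate, if_neg (Fin.succ_ne_zero i).symm, add_zero]
  rw [← h, Multiset.count_map, occupation_apply, Finset.card_def, Finset.filter_val]
  simp only [eq_comm]

/-- Only the set of positions where `f` is nonzero contributes to the coordinate `f`. -/
theorem sum_powersetCard_prod_ite {R : Type*} [CommSemiring R] {d n : ℕ} (m : ℕ)
    (ψ : Fin (d + 1) → R) (hψ : ψ 0 = 0) (f : Fin n → Fin (d + 1)) :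
    (∑ S ∈ Finset.powersetCard m (Finset.univ : Finset (Fin n)),
      ∏ j, (if j ∈ S then ψ (f j) else if f j = 0 then (1 : R) else 0)) =
      if ∑ i, occupation f i = m then ∏ i : Fin d, ψ i.succ ^ occupation f i else 0 := by
  rw [sum_occupation, prod_pow_occupation]
  have hS : ∀ S : Finset (Fin n), S ≠ (Finset.univ.filter fun j => f j ≠ 0) →
      ∏ j, (if j ∈ S then ψ (f j) else if f j = 0 then (1 : R) else 0) = 0 := by
    intro S hne
    obtain ⟨j, hj⟩ : ∃ j, ¬ (j ∈ S ↔ f j ≠ 0) := by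
      by_contra! h
      exact hne (by ext j; simpa using h j)
    refine Finset.prod_eq_zero (Finset.mem_univ j) ?_
    by_cases h : j ∈ S <;> by_cases h' : f j = 0 <;> simp_all
  split_ifs with h
  · rw [Finset.sum_eq_single_of_mem (Finset.univ.filter fun j => f j ≠ 0)
      (by simp [Finset.mem_powersetCard, h]) fun S _ => hS S]
    refine Finset.prod_congr rfl fun j _ => ?_
    by_cases h' : f j = 0 <;> simp [h']
  · refine Finset.sum_eq_zero fun S hmem => hS S ?_
    rintro rfl
    exact h (Finset.mem_powersetCard.1 hmem).2

/-- Vectors of values of finitely many distinct monomials span the whole space. -/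
theorem span_range_monomial_values {K σ : Type*} [Field K] [Infinite K] [Fintype σ]
    (I : Finset (σ →₀ ℕ)) :
    Submodule.span K (Set.range fun (φ : σ → K) (t : I) => ∏ i, φ i ^ t.1 i) = ⊤ := by
  classical
  by_contra hne
  obtain ⟨g, hg, hle⟩ := Submodule.exists_le_ker_of_lt_top _ (lt_top_iff_ne_top.2 hne)
  let c : I → K := fun t => g (Pi.single t 1)
  have hgc : ∀ x : I → K, g x = ∑ t, x t * c t := fun x => by
    rw [LinearMap.pi_apply_eq_sum_univ g x]
    refine Finset.sum_congr rfl fun t _ => ?_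
    rw [smul_eq_mul]
    congr 2
    ext s
    simp [Pi.single_apply, eq_comm]
  let p : MvPolynomial σ K := ∑ t : I, MvPolynomial.monomial t.1 (c t)
  have hp : p = 0 := by
    refine MvPolynomial.funext fun φ => ?_
    have h := LinearMap.mem_ker.1 (hle (Submodule.subset_span ⟨φ, rfl⟩))
    rw [hgc] at h
    rw [map_zero, ← h, map_sum]
    refine Finset.sum_congr rfl fun t _ => ?_
    rw [MvPolynomial.eval_monomial, Finsupp.prod_fintype _ _ fun _ => pow_zero _, mul_comm]
  refine hg (LinearMap.ext fun x => ?_)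
  rw [hgc, LinearMap.zero_apply]
  refine Finset.sum_eq_zero fun t _ => ?_
  have h : p.coeff t.1 = c t := by
    simp [p, MvPolynomial.coeff_sum, MvPolynomial.coeff_monomial]
  rw [← h, hp, MvPolynomial.coeff_zero, mul_zero]

/-- The linear map sending a function of occupation numbers, extended by zero off `I`, to the
corresponding tensor. -/
def tensorOfOccupation (K : Type*) [Field K] {d : ℕ} (n : ℕ) (I : Finset (Fin d →₀ ℕ)) :
    (I → K) →ₗ[K] ((Fin n → Fin (d + 1)) → K) where
  toFun c f := if h : occupation f ∈ I then c ⟨occupation f, h⟩ else 0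
  map_add' c c' := by
    ext f
    by_cases h : occupation f ∈ I <;> simp [h]
  map_smul' a c := by
    ext f
    by_cases h : occupation f ∈ I <;> simp [h]

theorem tensorOfOccupation_apply {K : Type*} [Field K] {d n : ℕ} (I : Finset (Fin d →₀ ℕ))
    (c : I → K) (f : Fin n → Fin (d + 1)) :
    tensorOfOccupation K n I c f =
      if h : occupation f ∈ I then c ⟨occupation f, h⟩ else 0 := rfl

theorem tensorOfOccupation_injective {K : Type*} [Field K] {d n : ℕ} (I : Finset (Fin d →₀ ℕ))
    (hI : ∀ t ∈ I, ∑ i, t i ≤ n) : Function.Injective (tensorOfOccupation K n I) := by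
  intro c c' h
  ext ⟨t, ht⟩
  obtain ⟨f, rfl⟩ := exists_occupation_eq t (hI t ht)
  simpa [tensorOfOccupation_apply, ht] using congrFun h f

/-- the subspace
`A = span{ ∑_{|S| = m} ⊗_j w_j : ψ ⊥ |0⟩, w_j = ψ for j ∈ S, w_j = |0⟩ otherwise }`
of `(ℂ^{d+1})^{⊗n}` has dimension `binom(d+m-1, m)`. -/
theorem dim_symmetric_span (d n m : ℕ) (hd : 0 < d) (hn : 0 < n) (hm : 0 < m) (hnm : m ≤ n) :
    Module.finrank ℂ
      ↥(Submodule.span ℂ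
        { v : (Fin n → Fin (d + 1)) → ℂ |
          ∃ ψ : Fin (d + 1) → ℂ, ψ 0 = 0 ∧
            v = fun f => ∑ S ∈ Finset.powersetCard m (Finset.univ : Finset (Fin n)),
              ∏ j, (if j ∈ S then ψ (f j) else if f j = 0 then (1 : ℂ) else 0) }) =
      (d + m - 1).choose m := by
  let I : Finset (Fin d →₀ ℕ) := Finset.finsuppAntidiag Finset.univ m
  have hI : ∀ t : Fin d →₀ ℕ, t ∈ I ↔ ∑ i, t i = m := fun t => by
    simp [I, Finset.mem_finsuppAntidiag]
  have hval : ∀ ψ : Fin (d + 1) → ℂ, ψ 0 = 0 →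
      (fun f : Fin n → Fin (d + 1) => ∑ S ∈ Finset.powersetCard m Finset.univ,
        ∏ j, (if j ∈ S then ψ (f j) else if f j = 0 then (1 : ℂ) else 0)) =
      tensorOfOccupation ℂ n I fun t => ∏ i : Fin d, ψ i.succ ^ t.1 i := fun ψ hψ => by
    ext f
    rw [sum_powersetCard_prod_ite m ψ hψ f, tensorOfOccupation_apply]
    simp only [hI, dite_eq_ite]
  have hset : { v : (Fin n → Fin (d + 1)) → ℂ |
      ∃ ψ : Fin (d + 1) → ℂ, ψ 0 = 0 ∧
        v = fun f => ∑ S ∈ Finset.powersetCard m (Finset.univ : Finset (Fin n)),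
          ∏ j, (if j ∈ S then ψ (f j) else if f j = 0 then (1 : ℂ) else 0) } =
      tensorOfOccupation ℂ n I ''
        Set.range fun (φ : Fin d → ℂ) (t : I) => ∏ i, φ i ^ t.1 i := by
    ext v
    constructor
    · rintro ⟨ψ, hψ, rfl⟩
      exact ⟨_, ⟨fun i => ψ i.succ, rfl⟩, (hval ψ hψ).symm⟩
    · rintro ⟨_, ⟨φ, rfl⟩, rfl⟩
      refine ⟨Fin.cons 0 φ, rfl, ?_⟩
      rw [hval _ rfl]
      simp only [Fin.cons_succ]
  rw [hset, Submodule.span_image, span_range_monomial_values, Submodule.map_top,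
    LinearMap.finrank_range_of_inj
      (tensorOfOccupation_injective I fun t ht => ((hI t).1 ht).trans_le hnm),
    Module.finrank_fintype_fun_eq_card, Fintype.card_coe,
    Finset.card_finsuppAntidiag_nat_eq_choose, Finset.card_univ, Fintype.card_fin]

end
end

section
/- Let r, d_a, d_b, N be positive integers with d_a ≤ r·d_b, let Δ : ℂ^{d_a} → ℂ^{d_b}⊗ℂ^{r} be an isometry, and let a₁, …, a_r be vectors in ℂ^{N}. For a unitary U on ℂ^{d_b}⊗ℂ^{r} and i ∈ {1,…,r}, let K_i(U) = (I_{d_b}⊗⟨i|)·U·Δ, a d_b×d_a complex matrix, where ⟨i| contracts the ℂ^{r} factor against the i-th standard basis vector, and let vec(K_i(U)) ∈ ℂ^{d_b}⊗ℂ^{d_a} be its vectorization. Define the N×(d_b·d_a) matrix F(U_x, U_y) = Σ_{i=1}^{r} a_i · (vec(K_i(U_x)) − vec(K_i(U_y)))*. Then, for U_x and U_y independent Haar-random unitaries on ℂ^{d_b}⊗ℂ^{r}, E[‖F(U_x,U_y)‖_F²] = (2·d_a/r) · Σ_{i=1}^{r} ‖a_i‖². In particular, if a_i = vec(K'_i)/d₁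 for matrices K'_i with Σ_{i=1}^{r} ‖K'_i‖_F² = d₁ and if d_a = r(d₂−1)/2, then E[‖F(U_x,U_y)‖_F²] = (d₂−1)/d₁. -/
open scoped BigOperators
open Matrix MeasureTheory

noncomputable section

/-- The block `K_i(U) = (I_{d_b} ⊗ ⟨i|)·U·Δ`. -/
def Kblock (r da db : ℕ) (Δ : Matrix (Fin db × Fin r) (Fin da) ℂ)
    (U : Matrix (Fin db × Fin r) (Fin db × Fin r) ℂ) (i : Fin r) :
    Matrix (Fin db) (Fin da) ℂ :=
  fun x y => (U * Δ) (x, i) y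

/-- The matrix `F(U_x, U_y) = ∑_i a_i · (vec(K_i(U_x)) − vec(K_i(U_y)))^*`. -/
def Fmat (r da db N : ℕ) (Δ : Matrix (Fin db × Fin r) (Fin da) ℂ)
    (a : Fin r → Fin N → ℂ)
    (Ux Uy : Matrix (Fin db × Fin r) (Fin db × Fin r) ℂ) :
    Matrix (Fin N) (Fin db × Fin da) ℂ :=
  fun p q => ∑ i, a i p *
    star (Kblock r da db Δ Ux i q.1 q.2 - Kblock r da db Δ Uy i q.1 q.2)

section UnitaryIntegrals

variable {n : Type*} [Fintype n] [DecidableEq n]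

instance matrixBorelSpace {m k : Type*} [Countable m] [Countable k] :
    BorelSpace (Matrix m k ℂ) :=
  inferInstanceAs (BorelSpace (m → k → ℂ))

instance unitaryGroupCompactSpace : CompactSpace (Matrix.unitaryGroup n ℂ) := by
  have hK : IsCompact (Set.univ.pi fun _ : n => Set.univ.pi fun _ : n =>
      Metric.closedBall (0 : ℂ) 1) :=
    isCompact_univ_pi fun _ => isCompact_univ_pi fun _ => isCompact_closedBall _ _
  refine isCompact_iff_compactSpace.mp (hK.of_isClosed_subset
    (isClosed_unitary (R := Matrix n n ℂ)) ?_)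
  intro U hU i _ j _
  simpa using entry_norm_bound_of_unitary hU i j

instance unitaryGroupBorelSpace : BorelSpace (Matrix.unitaryGroup n ℂ) :=
  inferInstanceAs (BorelSpace {U : Matrix n n ℂ // U ∈ Matrix.unitaryGroup n ℂ})

theorem Continuous.integrable_unitaryGroup {E : Type*} [NormedAddCommGroup E]
    [SecondCountableTopology E] {f : Matrix.unitaryGroup n ℂ → E} (hf : Continuous f)
    (μ : Measure (Matrix.unitaryGroup n ℂ)) [IsFiniteMeasure μ] : Integrable f μ :=
  hf.integrable_of_hasCompactSupport (HasCompactSupport.of_compactSpace f)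

variable (μ : Measure (Matrix.unitaryGroup n ℂ)) [μ.IsMulLeftInvariant]

theorem integral_unitary_conj_offDiag (P : Matrix n n ℂ) {s t : n} (hst : s ≠ t) :
    ∫ U : Matrix.unitaryGroup n ℂ, ((U : Matrix n n ℂ) * P * (U : Matrix n n ℂ)ᴴ) s t ∂μ = 0 := by
  let v : n → ℂ := fun i => if i = s then -1 else 1
  have hD : Matrix.diagonal v ∈ Matrix.unitaryGroup n ℂ := by
    rw [Matrix.mem_unitaryGroup_iff, Matrix.star_eq_conjTranspose, Matrix.diagonal_conjTranspose,
      Matrix.diagonal_mul_diagonal, ← Matrix.diagonal_one]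
    congr 1
    ext i
    by_cases h : i = s <;> simp [v, h]
  have h := integral_mul_left_eq_self (μ := μ)
    (fun U : Matrix.unitaryGroup n ℂ => ((U : Matrix n n ℂ) * P * (U : Matrix n n ℂ)ᴴ) s t) ⟨_, hD⟩
  have key : ∀ U : Matrix n n ℂ, (Matrix.diagonal v * U * P * (Matrix.diagonal v * U)ᴴ) s t =
      -(U * P * Uᴴ) s t := by
    intro U
    rw [Matrix.conjTranspose_mul, Matrix.diagonal_conjTranspose, ← Matrix.mul_assoc,
      Matrix.mul_diagonal, Matrix.mul_assoc, Matrix.mul_assoc, Matrix.diagonal_mul,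
      ← Matrix.mul_assoc]
    simp [v, hst.symm]
  simp only [Submonoid.coe_mul, key, integral_neg] at h
  exact self_eq_neg.mp h.symm

theorem integral_unitary_conj_diag_eq (P : Matrix n n ℂ) (s t : n) :
    ∫ U : Matrix.unitaryGroup n ℂ, ((U : Matrix n n ℂ) * P * (U : Matrix n n ℂ)ᴴ) s s ∂μ =
      ∫ U : Matrix.unitaryGroup n ℂ, ((U : Matrix n n ℂ) * P * (U : Matrix n n ℂ)ᴴ) t t ∂μ := by
  have hS : Matrix.swap ℂ s t ∈ Matrix.unitaryGroup n ℂ := by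
    rw [Matrix.mem_unitaryGroup_iff, Matrix.star_eq_conjTranspose, Matrix.conjTranspose_swap,
      Matrix.swap_mul_self]
  have h := integral_mul_left_eq_self (μ := μ)
    (fun U : Matrix.unitaryGroup n ℂ => ((U : Matrix n n ℂ) * P * (U : Matrix n n ℂ)ᴴ) s s) ⟨_, hS⟩
  have key : ∀ U : Matrix n n ℂ, (Matrix.swap ℂ s t * U * P * (Matrix.swap ℂ s t * U)ᴴ) s s =
      (U * P * Uᴴ) t t := by
    intro U
    rw [Matrix.conjTranspose_mul, Matrix.conjTranspose_swap, ← Matrix.mul_assoc,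
      Matrix.mul_swap_apply_left, Matrix.mul_assoc, Matrix.mul_assoc, Matrix.swap_mul_apply_left,
      ← Matrix.mul_assoc]
  simp only [Submonoid.coe_mul, key] at h
  exact h.symm

theorem integral_unitary_conj_diag [IsProbabilityMeasure μ] (P : Matrix n n ℂ) (s : n) :
    ∫ U : Matrix.unitaryGroup n ℂ, ((U : Matrix n n ℂ) * P * (U : Matrix n n ℂ)ᴴ) s s ∂μ =
      P.trace / Fintype.card n := by
  have hsum : ∑ t, ∫ U : Matrix.unitaryGroup n ℂ,
      ((U : Matrix n n ℂ) * P * (U : Matrix n n ℂ)ᴴ) t t ∂μ = P.trace := by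
    rw [← integral_finsetSum]
    · have key : ∀ U : Matrix.unitaryGroup n ℂ,
          ∑ t, ((U : Matrix n n ℂ) * P * (U : Matrix n n ℂ)ᴴ) t t = P.trace := by
        intro U
        change Matrix.trace _ = _
        rw [Matrix.mul_assoc, Matrix.trace_mul_comm, Matrix.mul_assoc,
          ← Matrix.star_eq_conjTranspose, Matrix.mem_unitaryGroup_iff'.mp U.2, Matrix.mul_one]
      simp [key]
    · intro t _
      exact Continuous.integrable_unitaryGroup (by fun_prop) μ
  rw [Finset.sum_congr rfl fun t _ => integral_unitary_conj_diag_eq μ P t s] at hsum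
  have hcard : (Fintype.card n : ℂ) ≠ 0 := by
    have : Nonempty n := ⟨s⟩
    exact_mod_cast Fintype.card_ne_zero
  rw [← hsum, Finset.sum_const, Finset.card_univ, nsmul_eq_mul, mul_div_cancel_left₀ _ hcard]

/-- The first-order twirl of a matrix over the unitary group. -/
theorem integral_unitary_conj_apply [IsProbabilityMeasure μ] (P : Matrix n n ℂ) (s t : n) :
    ∫ U : Matrix.unitaryGroup n ℂ, ((U : Matrix n n ℂ) * P * (U : Matrix n n ℂ)ᴴ) s t ∂μ =
      if s = t then P.trace / Fintype.card n else 0 := by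
  split_ifs with h
  · rw [h, integral_unitary_conj_diag]
  · exact integral_unitary_conj_offDiag μ P h

end UnitaryIntegrals

section FrobeniusNorm

variable {r da db N : ℕ} (Δ : Matrix (Fin db × Fin r) (Fin da) ℂ) (a : Fin r → Fin N → ℂ)

theorem Fmat_eq_sub (X Y : Matrix (Fin db × Fin r) (Fin db × Fin r) ℂ) :
    Fmat r da db N Δ a X Y = Fmat r da db N Δ a X 0 - Fmat r da db N Δ a Y 0 := by
  ext p q
  simp [Fmat, Kblock, mul_sub]

theorem Fmat_neg_eq_add (X Y : Matrix (Fin db × Fin r) (Fin db × Fin r) ℂ) :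
    Fmat r da db N Δ a X (-Y) = Fmat r da db N Δ a X 0 + Fmat r da db N Δ a Y 0 := by
  ext p q
  simp [Fmat, Kblock, mul_add, Finset.sum_add_distrib]

theorem re_trace_conjTranspose_mul_parallelogram {m k : Type*} [Fintype m] [Fintype k]
    (A B : Matrix m k ℂ) :
    (Matrix.trace ((A - B)ᴴ * (A - B))).re + (Matrix.trace ((A + B)ᴴ * (A + B))).re =
      2 * (Matrix.trace (Aᴴ * A)).re + 2 * (Matrix.trace (Bᴴ * B)).re := by
  simp only [Matrix.conjTranspose_sub, Matrix.conjTranspose_add, Matrix.sub_mul, Matrix.mul_sub,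
    Matrix.add_mul, Matrix.mul_add, Matrix.trace_sub, Matrix.trace_add, Complex.sub_re,
    Complex.add_re]
  ring

theorem continuous_Fmat_left (Y : Matrix (Fin db × Fin r) (Fin db × Fin r) ℂ) :
    Continuous fun X => Fmat r da db N Δ a X Y := by
  refine continuous_matrix fun p q => ?_
  simp only [Fmat, Kblock]
  fun_prop

theorem trace_Fmat_zero (X : Matrix (Fin db × Fin r) (Fin db × Fin r) ℂ) :
    Matrix.trace ((Fmat r da db N Δ a X 0)ᴴ * Fmat r da db N Δ a X 0) =
      ∑ i, ∑ j, (∑ p, star (a i p) * a j p) *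
        ∑ x, (X * (Δ * Δᴴ) * Xᴴ) (x, i) (x, j) := by
  have h : ∀ s t, (X * (Δ * Δᴴ) * Xᴴ) s t = ∑ y, (X * Δ) s y * star ((X * Δ) t y) := by
    intro s t
    rw [← Matrix.mul_assoc, Matrix.mul_assoc, ← Matrix.conjTranspose_mul, Matrix.mul_apply]
    rfl
  have hL : Matrix.trace ((Fmat r da db N Δ a X 0)ᴴ * Fmat r da db N Δ a X 0) =
      ∑ x, ∑ y, ∑ p, ∑ i, ∑ j, (star (a i p) * a j p) *
        ((X * Δ) (x, i) y * star ((X * Δ) (x, j) y)) := by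
    simp only [Matrix.trace, Matrix.diag_apply, Matrix.mul_apply (M := (Fmat r da db N Δ a X 0)ᴴ),
      Matrix.conjTranspose_apply, Fmat, Kblock, Matrix.zero_mul, Matrix.zero_apply, sub_zero,
      star_sum, star_mul', star_star, Finset.sum_mul_sum, Fintype.sum_prod_type]
    refine Finset.sum_congr rfl fun x _ => Finset.sum_congr rfl fun y _ =>
      Finset.sum_congr rfl fun p _ => Finset.sum_congr rfl fun i _ =>
      Finset.sum_congr rfl fun j _ => by ring
  have hR : ∀ i j, (∑ p, star (a i p) * a j p) * ∑ x, (X * (Δ * Δᴴ) * Xᴴ) (x, i) (x, j) =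
      ∑ x, ∑ y, ∑ p, (star (a i p) * a j p) *
        ((X * Δ) (x, i) y * star ((X * Δ) (x, j) y)) := by
    intro i j
    simp only [h, Finset.mul_sum, Finset.sum_mul]
  simp only [hL, hR]
  have e1 : ∀ g : Fin db → Fin da → Fin N → Fin r → Fin r → ℂ,
      ∑ x, ∑ y, ∑ p, ∑ i, ∑ j, g x y p i j = ∑ i, ∑ j, ∑ x, ∑ y, ∑ p, g x y p i j := by
    intro g
    calc ∑ x, ∑ y, ∑ p, ∑ i, ∑ j, g x y p i j
        = ∑ u : Fin db × Fin da × Fin N, ∑ v : Fin r × Fin r, g u.1 u.2.1 u.2.2 v.1 v.2 := by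
          simp only [Fintype.sum_prod_type]
      _ = ∑ i, ∑ j, ∑ x, ∑ y, ∑ p, g x y p i j := by
          rw [Finset.sum_comm]
          simp only [Fintype.sum_prod_type]
  exact e1 _

theorem integral_trace_Fmat_zero (hdb : 0 < db) (hΔ : Δᴴ * Δ = 1)
    (μ : Measure (Matrix.unitaryGroup (Fin db × Fin r) ℂ)) [IsProbabilityMeasure μ]
    [μ.IsMulLeftInvariant] :
    ∫ U : Matrix.unitaryGroup (Fin db × Fin r) ℂ,
      Matrix.trace ((Fmat r da db N Δ a ↑U 0)ᴴ * Fmat r da db N Δ a ↑U 0) ∂μ =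
      (da / r : ℂ) * ∑ i, ∑ p, star (a i p) * a i p := by
  have hP : (Δ * Δᴴ).trace = da := by
    rw [Matrix.trace_mul_comm, hΔ, Matrix.trace_one, Fintype.card_fin]
  have hdb_ne : (db : ℂ) ≠ 0 := by exact_mod_cast hdb.ne'
  simp only [trace_Fmat_zero]
  rw [integral_finsetSum _ fun i _ => Continuous.integrable_unitaryGroup (by fun_prop) μ]
  rw [Finset.mul_sum]
  refine Finset.sum_congr rfl fun i _ => ?_
  rw [integral_finsetSum _ fun j _ => Continuous.integrable_unitaryGroup (by fun_prop) μ]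
  rw [Finset.sum_eq_single i]
  · rw [integral_const_mul,
      integral_finsetSum _ fun x _ => Continuous.integrable_unitaryGroup (by fun_prop) μ]
    simp only [integral_unitary_conj_apply, if_true, hP, Finset.sum_const, Finset.card_univ,
      Fintype.card_prod, Fintype.card_fin, nsmul_eq_mul, Nat.cast_mul]
    field_simp
  · intro j _ hj
    rw [integral_const_mul,
      integral_finsetSum _ fun x _ => Continuous.integrable_unitaryGroup (by fun_prop) μ]
    simp [integral_unitary_conj_apply, hj.symm]
  · simp

theorem integral_re_trace_Fmat_zero (hdb : 0 < db) (hΔ : Δᴴ * Δ = 1)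
    (μ : Measure (Matrix.unitaryGroup (Fin db × Fin r) ℂ)) [IsProbabilityMeasure μ]
    [μ.IsMulLeftInvariant] :
    ∫ U : Matrix.unitaryGroup (Fin db × Fin r) ℂ,
      (Matrix.trace ((Fmat r da db N Δ a ↑U 0)ᴴ * Fmat r da db N Δ a ↑U 0)).re ∂μ =
      (da / r : ℝ) * ∑ i, ∑ p, ‖a i p‖ ^ 2 := by
  have hF := continuous_Fmat_left Δ a 0
  have hint : Integrable (fun U : Matrix.unitaryGroup (Fin db × Fin r) ℂ =>
      Matrix.trace ((Fmat r da db N Δ a ↑U 0)ᴴ * Fmat r da db N Δ a ↑U 0)) μ :=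
    Continuous.integrable_unitaryGroup (by fun_prop) μ
  have h := integral_re hint
  rw [integral_trace_Fmat_zero Δ a hdb hΔ μ] at h
  refine h.trans ?_
  have hn : ∀ z : ℂ, star z * z = ((‖z‖ ^ 2 : ℝ) : ℂ) := fun z => by
    push_cast
    exact Complex.conj_mul' z
  simp only [hn]
  have hc : (da / r : ℂ) * ∑ i, ∑ p, ((‖a i p‖ ^ 2 : ℝ) : ℂ) =
      (((da / r : ℝ) * ∑ i, ∑ p, ‖a i p‖ ^ 2 : ℝ) : ℂ) := by
    push_cast
    rfl
  rw [hc]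
  exact Complex.ofReal_re _

theorem integral_integral_re_trace_Fmat (hdb : 0 < db) (hΔ : Δᴴ * Δ = 1)
    (μ : Measure (Matrix.unitaryGroup (Fin db × Fin r) ℂ)) [IsProbabilityMeasure μ]
    [μ.IsMulLeftInvariant] :
    (∫ Ux, ∫ Uy,
        (Matrix.trace ((Fmat r da db N Δ a ↑Ux ↑Uy)ᴴ * Fmat r da db N Δ a ↑Ux ↑Uy)).re
        ∂μ ∂μ) =
      (2 * (da : ℝ) / (r : ℝ)) * ∑ i, ∑ p, ‖a i p‖ ^ 2 := by
  let h : Matrix.unitaryGroup (Fin db × Fin r) ℂ → ℝ := fun U =>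
    (Matrix.trace ((Fmat r da db N Δ a ↑U 0)ᴴ * Fmat r da db N Δ a ↑U 0)).re
  have hF := continuous_Fmat_left Δ a 0
  have hh : Integrable h μ := Continuous.integrable_unitaryGroup (by fun_prop) μ
  have hI : ∫ U, h U ∂μ = (da / r : ℝ) * ∑ i, ∑ p, ‖a i p‖ ^ 2 :=
    integral_re_trace_Fmat_zero Δ a hdb hΔ μ
  have hinner : ∀ Ux : Matrix.unitaryGroup (Fin db × Fin r) ℂ, ∫ Uy : Matrix.unitaryGroup (Fin db × Fin r) ℂ,
      (Matrix.trace ((Fmat r da db N Δ a ↑Ux ↑Uy)ᴴ * Fmat r da db N Δ a ↑Ux ↑Uy)).re ∂μ =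
      h Ux + ∫ U, h U ∂μ := by
    intro Ux
    let f : Matrix.unitaryGroup (Fin db × Fin r) ℂ → ℝ := fun Uy =>
      (Matrix.trace ((Fmat r da db N Δ a ↑Ux ↑Uy)ᴴ * Fmat r da db N Δ a ↑Ux ↑Uy)).re
    have hf : Continuous f := by
      have hY : Continuous fun Y => Fmat r da db N Δ a ↑Ux Y := by
        rw [funext (Fmat_eq_sub Δ a ↑Ux)]
        fun_prop
      fun_prop
    have hpar : ∀ Uy : Matrix.unitaryGroup (Fin db × Fin r) ℂ, f Uy + f (-1 * Uy) = 2 * h Ux + 2 * h Uy := by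
      intro Uy
      have hneg : ((-1 * Uy : Matrix.unitaryGroup (Fin db × Fin r) ℂ) :
          Matrix (Fin db × Fin r) (Fin db × Fin r) ℂ) = -Uy := by
        rw [neg_one_mul]
        rfl
      simp only [f, hneg, Fmat_neg_eq_add]
      rw [Fmat_eq_sub]
      exact re_trace_conjTranspose_mul_parallelogram _ _
    have h1 : ∫ Uy, f (-1 * Uy) ∂μ = ∫ Uy, f Uy ∂μ := integral_mul_left_eq_self f (-1)
    have h2 : ∫ Uy, (f Uy + f (-1 * Uy)) ∂μ = ∫ Uy, f Uy ∂μ + ∫ Uy, f (-1 * Uy) ∂μ :=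
      integral_add (hf.integrable_unitaryGroup μ)
        (Continuous.integrable_unitaryGroup (by fun_prop) μ)
    simp only [hpar] at h2
    have h3 : ∫ Uy, 2 * h Uy ∂μ = 2 * ∫ Uy, h Uy ∂μ := integral_const_mul _ _
    rw [integral_add (integrable_const _) (hh.const_mul 2), h3, h1] at h2
    simp only [integral_const, probReal_univ, one_smul] at h2
    change ∫ Uy, f Uy ∂μ = _
    linarith
  simp only [hinner]
  rw [integral_add hh (integrable_const _)]
  simp only [integral_const, probReal_univ, one_smul, hI]
  ring

end FrobeniusNorm

/-- for independent Haar-random unitaries `U_x, U_y` on `ℂ^{d_b}⊗ℂ^r`,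
`E[‖F(U_x,U_y)‖_F²] = (2d_a/r)·∑_i ‖a_i‖²`.  In particular, if `a_i = vec(K'_i)/d₁` with
`∑_i ‖K'_i‖_F² = d₁` (equivalently `∑_i ‖a_i‖² = 1/d₁`) and `d_a = r(d₂-1)/2`, then
`E[‖F(U_x,U_y)‖_F²] = (d₂-1)/d₁`. -/
theorem expected_frobenius_norm_F (r da db N : ℕ) (hr : 0 < r) (hda : 0 < da) (hdb : 0 < db)
    (hN : 0 < N) (hdar : da ≤ r * db)
    (Δ : Matrix (Fin db × Fin r) (Fin da) ℂ) (hΔ : Δᴴ * Δ = 1)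
    (a : Fin r → Fin N → ℂ)
    (μ : Measure (Matrix.unitaryGroup (Fin db × Fin r) ℂ)) [IsProbabilityMeasure μ]
    [μ.IsMulLeftInvariant] [μ.IsMulRightInvariant] :
    (∫ Ux, ∫ Uy,
        (Matrix.trace ((Fmat r da db N Δ a ↑Ux ↑Uy)ᴴ * Fmat r da db N Δ a ↑Ux ↑Uy)).re
        ∂μ ∂μ) =
      (2 * (da : ℝ) / (r : ℝ)) * ∑ i, ∑ p, ‖a i p‖ ^ 2 ∧
    ∀ d₁ d₂ : ℕ, 0 < d₁ → 2 * da = r * (d₂ - 1) →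
      (∑ i, ∑ p, ‖a i p‖ ^ 2) = 1 / (d₁ : ℝ) →
      (∫ Ux, ∫ Uy,
          (Matrix.trace ((Fmat r da db N Δ a ↑Ux ↑Uy)ᴴ * Fmat r da db N Δ a ↑Ux ↑Uy)).re
          ∂μ ∂μ) = ((d₂ : ℝ) - 1) / (d₁ : ℝ) := by
  have main := integral_integral_re_trace_Fmat Δ a hdb hΔ μ
  refine ⟨main, fun d₁ d₂ hd₁ hd ha => ?_⟩
  have hd₂ : 1 ≤ d₂ := by
    by_contra hlt
    have h0 : d₂ - 1 = 0 := by omega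
    rw [h0] at hd
    omega
  have hd_real : 2 * (da : ℝ) = r * ((d₂ : ℝ) - 1) := by
    have := congrArg (Nat.cast : ℕ → ℝ) hd
    push_cast [Nat.cast_sub hd₂] at this
    exact this
  have hr_ne : (r : ℝ) ≠ 0 := by exact_mod_cast hr.ne'
  rw [main, ha, hd_real, mul_div_cancel_left₀ _ hr_ne]
  ring

end
end
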